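/- Let k ≥ 1/2 be real, t > 0 and x ∈ (0,1). With q_t(x,y) = ∑_{n=0}^∞ e^{−λ_n t}·G_n^{(k)}(cos(πx))·G_n^{(k)}(cos(πy))·ω_n^{(k)}·(sin(πy))^{2k}, one has ∫_0^1 q_t(x,y) dy = 1; that is, q_t(x,·) is a probability density on (0,1). -/

import Mathlib

open Real MeasureTheory

/-- The Gegenbauer polynomial `G_n^{(k)}` as a function of a real variable. -/
noncomputable def gegenbauer (k : ℝ) (n : ℕ) (y : ℝ) : ℝ :=
  (1 / Real.Gamma k) *
    ∑ m ∈ Finset.range (n / 2 + 1),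
      (-1 : ℝ) ^ m * Real.Gamma (k + n - m) /
          ((m.factorial : ℝ) * ((n - 2 * m).factorial : ℝ)) * (2 * y) ^ (n - 2 * m)

/-- The eigenvalue `λ_n = (π²/2) n (n + 2k)`. -/
noncomputable def lambdaAff (k : ℝ) (n : ℕ) : ℝ :=
  Real.pi ^ 2 / 2 * n * (n + 2 * k)

/-- The normalization constant `ω_n^{(k)}`. -/
noncomputable def omegaAff (k : ℝ) (n : ℕ) : ℝ :=
  (n.factorial : ℝ) * (k + n) * Real.Gamma k ^ 2 /
    ((2 : ℝ) ^ (1 - 2 * k) * Real.Gamma (n + 2 * k))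

/-- The transition density of the radial affine Dunkl process. -/
noncomputable def qDensity (k t x y : ℝ) : ℝ :=
  ∑' n : ℕ,
    Real.exp (-(lambdaAff k n) * t) * gegenbauer k n (Real.cos (Real.pi * x)) *
      gegenbauer k n (Real.cos (Real.pi * y)) * omegaAff k n *
        Real.sin (Real.pi * y) ^ (2 * k)

/-- The moment `∫₀¹ sin(πy)^{2k} cos(πy)^p dy`. -/
noncomputable def trigMoment (k : ℝ) (p : ℕ) : ℝ :=
  ∫ y in (0 : ℝ)..1, Real.sin (π * y) ^ (2 * k) * Real.cos (π * y) ^ p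

lemma sin_pi_mul_nonneg {y : ℝ} (hy : y ∈ Set.Icc (0 : ℝ) 1) : 0 ≤ Real.sin (π * y) :=
  Real.sin_nonneg_of_nonneg_of_le_pi (mul_nonneg pi_pos.le hy.1)
    (by nlinarith [pi_pos, hy.2])

lemma continuous_sin_rpow_mul_cos_pow {a : ℝ} (ha : 0 ≤ a) (p : ℕ) :
    Continuous fun y : ℝ => Real.sin (π * y) ^ a * Real.cos (π * y) ^ p := by
  refine Continuous.mul ?_ (by fun_prop)
  exact Continuous.rpow_const (by fun_prop) fun _ => Or.inr ha

lemma integral_deriv_sin_rpow_mul_cos_pow {k : ℝ} (hk : 0 < k) (p : ℕ) :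
    ∫ y in (0 : ℝ)..1, ((2 * k + 1) * (Real.sin (π * y) ^ (2 * k) * Real.cos (π * y) ^ (p + 1))
      - p * (Real.sin (π * y) ^ (2 * k) * Real.cos (π * y) ^ (p - 1)
        * Real.sin (π * y) ^ 2)) = 0 := by
  have hderiv : ∀ y ∈ Set.uIcc (0 : ℝ) 1,
      HasDerivAt (fun y => π⁻¹ * (Real.sin (π * y) ^ (2 * k + 1) * Real.cos (π * y) ^ p))
        ((2 * k + 1) * (Real.sin (π * y) ^ (2 * k) * Real.cos (π * y) ^ (p + 1))
          - p * (Real.sin (π * y) ^ (2 * k) * Real.cos (π * y) ^ (p - 1)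
            * Real.sin (π * y) ^ 2)) y := by
    intro y hy
    rw [Set.uIcc_of_le zero_le_one] at hy
    have hl : HasDerivAt (fun y : ℝ => π * y) π y := by
      simpa using (hasDerivAt_id y).const_mul π
    have hs := (hl.sin.rpow_const (p := 2 * k + 1) (Or.inr (by linarith)))
    have hc := (hl.cos.pow p)
    refine ((hs.mul hc).const_mul π⁻¹).congr_deriv ?_
    have hr : Real.sin (π * y) ^ (2 * k + 1) = Real.sin (π * y) ^ (2 * k) * Real.sin (π * y) :=
      Real.rpow_add_one' (sin_pi_mul_nonneg hy) (by linarith)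
    simp only [Pi.pow_apply]
    rw [hr, add_sub_cancel_right]
    field_simp
    ring
  rw [intervalIntegral.integral_eq_sub_of_hasDerivAt hderiv]
  · have : (2 * k + 1) ≠ 0 := by linarith
    simp [Real.zero_rpow this]
  · apply Continuous.intervalIntegrable
    have h1 := continuous_sin_rpow_mul_cos_pow (a := 2 * k) (by linarith) (p + 1)
    have h2 := continuous_sin_rpow_mul_cos_pow (a := 2 * k) (by linarith) (p - 1)
    exact (h1.const_mul _).sub ((h2.mul (by fun_prop)).const_mul _)

lemma trigMoment_one {k : ℝ} (hk : 0 < k) : trigMoment k 1 = 0 := by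
  have h := integral_deriv_sin_rpow_mul_cos_pow hk 0
  simp only [Nat.cast_zero, zero_mul, sub_zero, zero_add,
    intervalIntegral.integral_const_mul] at h
  exact (mul_eq_zero.1 h).resolve_left (by linarith)

lemma trigMoment_add_two {k : ℝ} (hk : 0 < k) (q : ℕ) :
    (q + 2 + 2 * k) * trigMoment k (q + 2) = (q + 1) * trigMoment k q := by
  have h := integral_deriv_sin_rpow_mul_cos_pow hk (q + 1)
  have hi : ∀ p, IntervalIntegrable
      (fun y : ℝ => Real.sin (π * y) ^ (2 * k) * Real.cos (π * y) ^ p) volume 0 1 := fun p =>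
    (continuous_sin_rpow_mul_cos_pow (by linarith) p).intervalIntegrable _ _
  have he : ∀ y : ℝ, ((2 * k + 1) * (Real.sin (π * y) ^ (2 * k) * Real.cos (π * y) ^ (q + 1 + 1))
      - (q + 1 : ℕ) * (Real.sin (π * y) ^ (2 * k) * Real.cos (π * y) ^ (q + 1 - 1)
        * Real.sin (π * y) ^ 2)) =
      (q + 2 + 2 * k) * (Real.sin (π * y) ^ (2 * k) * Real.cos (π * y) ^ (q + 2)) -
      (q + 1) * (Real.sin (π * y) ^ (2 * k) * Real.cos (π * y) ^ q) := by
    intro y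
    rw [Real.sin_sq, Nat.add_sub_cancel]
    push_cast
    ring
  simp only [he] at h
  rw [intervalIntegral.integral_sub ((hi _).const_mul _) ((hi _).const_mul _),
    intervalIntegral.integral_const_mul, intervalIntegral.integral_const_mul] at h
  exact sub_eq_zero.1 h

/-- The coefficient of `y^{n-2m}` in `Γ(k) G_n^{(k)}(y)`. -/
noncomputable def gegenbauerCoeff (k : ℝ) (n m : ℕ) : ℝ :=
  (-1 : ℝ) ^ m * Real.Gamma (k + n - m) /
    ((m.factorial : ℝ) * ((n - 2 * m).factorial : ℝ)) * 2 ^ (n - 2 * m)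

lemma gegenbauer_eq_sum (k : ℝ) (n : ℕ) (y : ℝ) :
    gegenbauer k n y = (1 / Real.Gamma k) *
      ∑ m ∈ Finset.range (n / 2 + 1), gegenbauerCoeff k n m * y ^ (n - 2 * m) := by
  simp only [gegenbauer, gegenbauerCoeff, mul_pow, mul_assoc]

lemma gegenbauerCoeff_succ {k : ℝ} (hk : 0 < k) {m q : ℕ} :
    (q + 2) * (q + 1) * gegenbauerCoeff k (q + 2 * (m + 1)) m =
      -(4 * (m + 1) * (k + q + m + 1) * gegenbauerCoeff k (q + 2 * (m + 1)) (m + 1)) := by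
  have e1 : q + 2 * (m + 1) - 2 * m = q + 2 := by omega
  have e2 : q + 2 * (m + 1) - 2 * (m + 1) = q := by omega
  have hG : Real.Gamma (k + (q + 2 * (m + 1) : ℕ) - m) =
      (k + q + m + 1) * Real.Gamma (k + (q + 2 * (m + 1) : ℕ) - (m + 1 : ℕ)) := by
    rw [← show k + (q + 2 * (m + 1) : ℕ) - (m + 1 : ℕ) = k + q + m + 1 by push_cast; ring,
      ← Real.Gamma_add_one]
    · congr 1; push_cast; ring
    · push_cast; nlinarith [(q.cast_nonneg : (0 : ℝ) ≤ q), (m.cast_nonneg : (0 : ℝ) ≤ m)]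
  have hm : ((m.factorial : ℕ) : ℝ) ≠ 0 := by positivity
  have hq : ((q.factorial : ℕ) : ℝ) ≠ 0 := by positivity
  unfold gegenbauerCoeff
  rw [e1, e2, hG]
  simp only [Nat.factorial_succ, Nat.cast_mul]
  push_cast
  field_simp
  ring

lemma sum_gegenbauerCoeff_mul_trigMoment {k : ℝ} (hk : 0 < k) (M : ℕ) : ∀ q : ℕ,
    ((q + 2 * M : ℕ) : ℝ) * ((q + 2 * M : ℕ) + 2 * k) * ∑ m ∈ Finset.range (M + 1),
      gegenbauerCoeff k (q + 2 * M) m * trigMoment k (q + 2 * M - 2 * m) =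
    q * (q + 2 * k) * gegenbauerCoeff k (q + 2 * M) M * trigMoment k q := by
  induction M with
  | zero => intro q; simp; ring
  | succ M ih =>
    intro q
    have h := ih (q + 2)
    rw [show q + 2 + 2 * M = q + 2 * (M + 1) by ring] at h
    rw [Finset.sum_range_succ, mul_add, h, Nat.add_sub_cancel]
    have h1 := trigMoment_add_two hk q
    have h2 := gegenbauerCoeff_succ hk (m := M) (q := q)
    push_cast at h1 h2 ⊢
    linear_combination (q + 2) * gegenbauerCoeff k (q + 2 * (M + 1)) M * h1 +
      trigMoment k q * h2

lemma integral_sin_rpow_mul_gegenbauer {k : ℝ} (hk : 0 < k) {n : ℕ} (hn : n ≠ 0) :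
    ∫ y in (0 : ℝ)..1, Real.sin (π * y) ^ (2 * k) * gegenbauer k n (Real.cos (π * y)) = 0 := by
  have he : ∀ y : ℝ, Real.sin (π * y) ^ (2 * k) * gegenbauer k n (Real.cos (π * y)) =
      (1 / Real.Gamma k) * ∑ m ∈ Finset.range (n / 2 + 1), gegenbauerCoeff k n m *
        (Real.sin (π * y) ^ (2 * k) * Real.cos (π * y) ^ (n - 2 * m)) := by
    intro y
    rw [gegenbauer_eq_sum, mul_left_comm, Finset.mul_sum]
    congr 1
    exact Finset.sum_congr rfl fun _ _ => by ring
  simp only [he]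
  rw [intervalIntegral.integral_const_mul, intervalIntegral.integral_finsetSum]
  swap
  · exact fun m _ => ((continuous_sin_rpow_mul_cos_pow (by linarith) _).const_mul
      _).intervalIntegrable _ _
  simp only [intervalIntegral.integral_const_mul]
  have h := sum_gegenbauerCoeff_mul_trigMoment hk (n / 2) (n % 2)
  rw [Nat.mod_add_div n 2] at h
  have hz : (n % 2 : ℕ) * ((n % 2 : ℕ) + 2 * k) * gegenbauerCoeff k n (n / 2)
      * trigMoment k (n % 2) = 0 := by
    rcases Nat.mod_two_eq_zero_or_one n with h0 | h0 <;> rw [h0]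
    · simp
    · simp [trigMoment_one hk]
  rw [hz] at h
  have hn' : (0 : ℝ) < n := by exact_mod_cast Nat.pos_of_ne_zero hn
  have h3 := (mul_eq_zero.1 h).resolve_left (by positivity)
  simp only [trigMoment] at h3
  rw [h3, mul_zero]

lemma integral_rpow_mul_one_sub_rpow {u v : ℝ} (hu : 0 < u) (hv : 0 < v) :
    ∫ x in (0 : ℝ)..1, x ^ (u - 1) * (1 - x) ^ (v - 1) =
      Real.Gamma u * Real.Gamma v / Real.Gamma (u + v) := by
  have h := Complex.betaIntegral_eq_Gamma_mul_div u v (by simpa) (by simpa)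
  rw [← Complex.ofReal_add, Complex.Gamma_ofReal, Complex.Gamma_ofReal, Complex.Gamma_ofReal,
    Complex.betaIntegral] at h
  have he : ∫ x in (0 : ℝ)..1, (x : ℂ) ^ ((u : ℂ) - 1) * (1 - (x : ℂ)) ^ ((v : ℂ) - 1) =
      ∫ x in (0 : ℝ)..1, ((x ^ (u - 1) * (1 - x) ^ (v - 1) : ℝ) : ℂ) := by
    refine intervalIntegral.integral_congr fun x hx => ?_
    rw [Set.uIcc_of_le zero_le_one] at hx
    have hx1 : 0 ≤ 1 - x := by linarith [hx.2]
    push_cast [Complex.ofReal_cpow hx.1, Complex.ofReal_cpow hx1]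
    rfl
  rw [he, intervalIntegral.integral_ofReal] at h
  exact_mod_cast h

lemma trigMoment_zero {k : ℝ} (hk : 1 / 2 ≤ k) :
    trigMoment k 0 = 2 ^ (2 * k) / π *
      (Real.Gamma (k + 1 / 2) ^ 2 / Real.Gamma (2 * k + 1)) := by
  have hd : ∀ y ∈ Set.uIcc (0 : ℝ) 1, HasDerivAt (fun y : ℝ => (1 - Real.cos (π * y)) / 2)
      (π / 2 * Real.sin (π * y)) y := by
    intro y _
    have hl : HasDerivAt (fun y : ℝ => π * y) π y := by
      simpa using (hasDerivAt_id y).const_mul π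
    refine ((hl.cos.const_sub 1).div_const 2).congr_deriv ?_
    ring
  have hg : Continuous fun u : ℝ => u ^ (k + 1 / 2 - 1) * (1 - u) ^ (k + 1 / 2 - 1) :=
    (Continuous.rpow_const continuous_id fun _ => Or.inr (by linarith)).mul
      (Continuous.rpow_const (by fun_prop) fun _ => Or.inr (by linarith))
  have h := intervalIntegral.integral_comp_mul_deriv (a := 0) (b := 1) hd
    (by fun_prop) hg
  simp only [mul_zero, Real.cos_zero, sub_self, zero_div, mul_one, Real.cos_pi] at h
  rw [show (1 - -1 : ℝ) / 2 = 1 by norm_num,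
    integral_rpow_mul_one_sub_rpow (by linarith) (by linarith)] at h
  have he : ∫ y in (0 : ℝ)..1, ((fun u : ℝ => u ^ (k + 1 / 2 - 1) * (1 - u) ^ (k + 1 / 2 - 1)) ∘
        fun y => (1 - Real.cos (π * y)) / 2) y * (π / 2 * Real.sin (π * y)) =
      ∫ y in (0 : ℝ)..1, (π / 2 ^ (2 * k)) *
        (Real.sin (π * y) ^ (2 * k) * Real.cos (π * y) ^ 0) := by
    refine intervalIntegral.integral_congr fun y hy => ?_
    rw [Set.uIcc_of_le zero_le_one] at hy
    have hs := sin_pi_mul_nonneg hy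
    simp only [Function.comp, pow_zero, mul_one]
    rw [← Real.mul_rpow (by linarith [Real.cos_le_one (π * y)])
      (by linarith [Real.neg_one_le_cos (π * y)]),
      show (1 - Real.cos (π * y)) / 2 * (1 - (1 - Real.cos (π * y)) / 2) =
        (Real.sin (π * y) / 2) ^ (2 : ℝ) by
          rw [Real.rpow_two, div_pow, Real.sin_sq]; ring,
      ← Real.rpow_mul (by positivity),
      show π / 2 * Real.sin (π * y) = π * (Real.sin (π * y) / 2) by ring, mul_left_comm,
      ← Real.rpow_add_one' (by positivity) (by linarith),
      show 2 * (k + 1 / 2 - 1) + 1 = 2 * k by ring, Real.div_rpow hs (by norm_num)]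
    ring
  rw [he, intervalIntegral.integral_const_mul] at h
  rw [trigMoment, show 2 * k + 1 = k + 1 / 2 + (k + 1 / 2) by ring, pow_two, ← h]
  have : (2 : ℝ) ^ (2 * k) ≠ 0 := by positivity
  have := pi_ne_zero
  field_simp

lemma omegaAff_zero_mul_trigMoment_zero {k : ℝ} (hk : 1 / 2 ≤ k) :
    omegaAff k 0 * trigMoment k 0 = 1 := by
  have hk0 : 0 < k := by linarith
  have h := Real.Gamma_mul_Gamma_add_half k
  rw [trigMoment_zero hk, omegaAff, Real.Gamma_add_one (by linarith)]
  have h1 : Real.Gamma (2 * k) ≠ 0 := (Real.Gamma_pos_of_pos (by linarith)).ne'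
  have h2 : (2 : ℝ) ^ (2 * k) ≠ 0 := by positivity
  have h3 := pi_ne_zero
  have h4 : (2 : ℝ) ^ (1 - 2 * k) = 2 / 2 ^ (2 * k) := by
    rw [Real.rpow_sub two_pos, Real.rpow_one]
  have h5 : (√π) ^ 2 = π := Real.sq_sqrt pi_pos.le
  have h6 : (Real.Gamma k * Real.Gamma (k + 1 / 2)) ^ 2 =
      Real.Gamma (2 * k) ^ 2 * (2 / 2 ^ (2 * k)) ^ 2 * π := by
    rw [h, h4, mul_pow, mul_pow, h5]
  rw [h4]
  simp only [Nat.factorial_zero, Nat.cast_one, Nat.cast_zero, add_zero, zero_add, one_mul]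
  field_simp at h6 ⊢
  linear_combination h6

lemma Gamma_add_nat_le {k : ℝ} (hk : 0 < k) {n j : ℕ} (hj : j ≤ n) :
    Real.Gamma (k + j) ≤ Real.Gamma k * (k + 1 + n) ^ j := by
  induction j with
  | zero => simp
  | succ j ih =>
    have hjn : (j : ℝ) ≤ n := by exact_mod_cast (Nat.le_of_succ_le hj)
    rw [Nat.cast_succ, ← add_assoc, Real.Gamma_add_one (by positivity), pow_succ, mul_comm,
      ← mul_assoc]
    exact mul_le_mul (ih (Nat.le_of_succ_le hj)) (by linarith) (by positivity)
      (mul_nonneg (Real.Gamma_pos_of_pos hk).le (by positivity))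

lemma Gamma_mul_factorial_le {a : ℝ} (ha : 1 ≤ a) (n : ℕ) :
    Real.Gamma a * n.factorial ≤ Real.Gamma (n + a) := by
  induction n with
  | zero => simp
  | succ n ih =>
    rw [Nat.cast_succ, add_right_comm, Real.Gamma_add_one (by positivity), Nat.factorial_succ]
    push_cast
    rw [mul_left_comm]
    exact mul_le_mul (by linarith) ih
      (mul_nonneg (Real.Gamma_pos_of_pos (by linarith)).le (by positivity)) (by positivity)

lemma omegaAff_nonneg {k : ℝ} (hk : 0 < k) (n : ℕ) : 0 ≤ omegaAff k n := by
  have := Real.Gamma_pos_of_pos (show 0 < n + 2 * k by positivity)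
  unfold omegaAff
  positivity

lemma omegaAff_le {k : ℝ} (hk : 1 / 2 ≤ k) (n : ℕ) :
    omegaAff k n ≤ Real.Gamma k ^ 2 / (2 ^ (1 - 2 * k) * Real.Gamma (2 * k)) * (k + 1 + n) := by
  have hG : 0 < Real.Gamma (2 * k) := Real.Gamma_pos_of_pos (by linarith)
  have hG' : 0 < Real.Gamma (n + 2 * k) := Real.Gamma_pos_of_pos (by positivity)
  have h := Gamma_mul_factorial_le (show 1 ≤ 2 * k by linarith) n
  have hk0 : 0 < k := by linarith
  unfold omegaAff
  rw [div_mul_eq_mul_div, div_le_div_iff₀ (by positivity) (by positivity)]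
  calc n.factorial * (k + n) * Real.Gamma k ^ 2 * (2 ^ (1 - 2 * k) * Real.Gamma (2 * k))
      = (Real.Gamma k ^ 2 * 2 ^ (1 - 2 * k)) *
          ((k + n) * (Real.Gamma (2 * k) * n.factorial)) := by ring
    _ ≤ (Real.Gamma k ^ 2 * 2 ^ (1 - 2 * k)) * ((k + 1 + n) * Real.Gamma (n + 2 * k)) := by
        gcongr
        linarith
    _ = _ := by ring

lemma abs_gegenbauer_le {k : ℝ} (hk : 0 < k) (n : ℕ) {y : ℝ} (hy : |y| ≤ 1) :
    |gegenbauer k n y| ≤ (k + 1 + n) * (2 * (k + 1 + n)) ^ n := by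
  have hG := Real.Gamma_pos_of_pos hk
  rw [gegenbauer_eq_sum, abs_mul, abs_of_pos (by positivity), one_div_mul_eq_div,
    div_le_iff₀ hG]
  have hterm : ∀ m ∈ Finset.range (n / 2 + 1), |gegenbauerCoeff k n m * y ^ (n - 2 * m)| ≤
      Real.Gamma k * (2 * (k + 1 + n)) ^ n := by
    intro m hm
    have hmn : m ≤ n := by have := Finset.mem_range.1 hm; omega
    have hΓ := Gamma_add_nat_le hk (Nat.sub_le n m)
    rw [Nat.cast_sub hmn, ← add_sub_assoc] at hΓ
    have hpos : 0 < Real.Gamma (k + n - m) := by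
      have : (m : ℝ) ≤ n := by exact_mod_cast hmn
      exact Real.Gamma_pos_of_pos (by linarith)
    have hs : (1 : ℝ) ≤ k + 1 + n := by linarith [(n.cast_nonneg : (0 : ℝ) ≤ n)]
    have hf : (1 : ℝ) ≤ m.factorial * (n - 2 * m).factorial := by
      exact_mod_cast Nat.mul_pos (Nat.factorial_pos _) (Nat.factorial_pos _)
    rw [gegenbauerCoeff, abs_mul, abs_mul, abs_div, abs_mul, abs_pow, abs_pow, abs_pow, abs_neg,
      abs_one, one_pow, one_mul, abs_of_pos hpos, abs_of_pos (two_pos : (0 : ℝ) < 2),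
      abs_of_pos (by positivity : (0 : ℝ) < m.factorial * (n - 2 * m).factorial)]
    calc Real.Gamma (k + n - m) / (m.factorial * (n - 2 * m).factorial) * 2 ^ (n - 2 * m)
          * |y| ^ (n - 2 * m)
        ≤ Real.Gamma (k + n - m) * 2 ^ n * 1 := by
          gcongr
          · exact div_le_self hpos.le hf
          · norm_num
          · exact Nat.sub_le _ _
          · exact pow_le_one₀ (abs_nonneg _) hy
      _ ≤ (Real.Gamma k * (k + 1 + n) ^ n) * 2 ^ n * 1 := by
          gcongr
          refine hΓ.trans ?_
          gcongr
          exact Nat.sub_le _ _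
      _ = _ := by rw [mul_pow]; ring
  calc |∑ m ∈ Finset.range (n / 2 + 1), gegenbauerCoeff k n m * y ^ (n - 2 * m)|
      ≤ ∑ m ∈ Finset.range (n / 2 + 1), |gegenbauerCoeff k n m * y ^ (n - 2 * m)| :=
        Finset.abs_sum_le_sum_abs _ _
    _ ≤ (Finset.range (n / 2 + 1)).card • (Real.Gamma k * (2 * (k + 1 + n)) ^ n) :=
        Finset.sum_le_card_nsmul _ _ _ hterm
    _ ≤ (k + 1 + n) * (Real.Gamma k * (2 * (k + 1 + n)) ^ n) := by
        rw [Finset.card_range, nsmul_eq_mul]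
        gcongr
        have : ((n / 2 : ℕ) : ℝ) ≤ n := by exact_mod_cast Nat.div_le_self n 2
        push_cast
        linarith
    _ = _ := by ring

lemma summable_pow_mul_pow_mul_exp_neg_sq {a c : ℝ} (ha : 1 ≤ a) (hc : 0 < c) :
    Summable fun n : ℕ => (a + n) ^ 3 * (4 * (a + n) ^ 2) ^ n * Real.exp (-(c * n ^ 2)) := by
  have hlim : Filter.Tendsto (fun n : ℕ => 4 * (a + n) ^ 5 * Real.exp (-(c * n)))
      Filter.atTop (nhds 0) := by
    have h1 : Filter.Tendsto (fun n : ℕ => c * (a + n)) Filter.atTop Filter.atTop :=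
      (Filter.tendsto_atTop_add_const_left _ a tendsto_natCast_atTop_atTop).const_mul_atTop hc
    have h2 := ((Real.tendsto_pow_mul_exp_neg_atTop_nhds_zero 5).comp h1).const_mul
      (4 / c ^ 5 * Real.exp (c * a))
    rw [mul_zero] at h2
    refine h2.congr fun n => ?_
    have : Real.exp (-(c * n)) = Real.exp (c * a) * Real.exp (-(c * (a + n))) := by
      rw [← Real.exp_add]; congr 1; ring
    simp only [Function.comp, this]
    field_simp
  refine Summable.of_norm_bounded_eventually_nat
    (summable_geometric_of_lt_one (r := (1 / 2 : ℝ)) (by norm_num) (by norm_num)) ?_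
  filter_upwards [hlim.eventually_le_const (show (0 : ℝ) < 1 / 2 by norm_num),
    Filter.eventually_ge_atTop 1] with n hn hn1
  have hs : 1 ≤ a + n := by linarith [(n.cast_nonneg : (0 : ℝ) ≤ n)]
  rw [Real.norm_of_nonneg (by positivity)]
  calc (a + n) ^ 3 * (4 * (a + n) ^ 2) ^ n * Real.exp (-(c * n ^ 2))
      ≤ ((a + n) ^ 3) ^ n * (4 * (a + n) ^ 2) ^ n * Real.exp (-(c * n ^ 2)) := by
        gcongr
        exact le_self_pow₀ (one_le_pow₀ hs) (by omega)
    _ = (4 * (a + n) ^ 5 * Real.exp (-(c * n))) ^ n := by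
        rw [show -(c * (n : ℝ) ^ 2) = n * -(c * n) by ring, Real.exp_nat_mul, ← mul_pow,
          ← mul_pow]
        congr 1; ring
    _ ≤ (1 / 2) ^ n := by gcongr

/-- The `n`-th term of the series defining `qDensity`. -/
noncomputable def qDensityTerm (k t x : ℝ) (n : ℕ) (y : ℝ) : ℝ :=
  Real.exp (-(lambdaAff k n) * t) * gegenbauer k n (Real.cos (Real.pi * x)) *
    gegenbauer k n (Real.cos (Real.pi * y)) * omegaAff k n * Real.sin (Real.pi * y) ^ (2 * k)

lemma continuous_qDensityTerm {k : ℝ} (hk : 0 < k) (t x : ℝ) (n : ℕ) :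
    Continuous (qDensityTerm k t x n) := by
  unfold qDensityTerm gegenbauer
  refine Continuous.mul (by fun_prop) ?_
  exact Continuous.rpow_const (by fun_prop) fun _ => Or.inr (by linarith)

lemma norm_qDensityTerm_le {k t : ℝ} (hk : 1 / 2 ≤ k) (ht : 0 < t) (x : ℝ) (n : ℕ) {y : ℝ}
    (hy : y ∈ Set.Icc (0 : ℝ) 1) :
    ‖qDensityTerm k t x n y‖ ≤
      Real.Gamma k ^ 2 / (2 ^ (1 - 2 * k) * Real.Gamma (2 * k)) *
        ((k + 1 + n) ^ 3 * (4 * (k + 1 + n) ^ 2) ^ n * Real.exp (-(π ^ 2 / 2 * t * n ^ 2))) := by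
  have hk0 : 0 < k := by linarith
  have hG : 0 < Real.Gamma (2 * k) := Real.Gamma_pos_of_pos (by linarith)
  have hs := sin_pi_mul_nonneg hy
  have h1 := abs_gegenbauer_le hk0 n (Real.abs_cos_le_one (π * x))
  have h2 := abs_gegenbauer_le hk0 n (Real.abs_cos_le_one (π * y))
  have h3 := omegaAff_le hk n
  have h4 : Real.sin (π * y) ^ (2 * k) ≤ 1 :=
    Real.rpow_le_one hs (Real.sin_le_one _) (by linarith)
  have h5 : Real.exp (-(lambdaAff k n) * t) ≤ Real.exp (-(π ^ 2 / 2 * t * n ^ 2)) := by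
    rw [Real.exp_le_exp, lambdaAff]
    have : 0 ≤ π ^ 2 * n * k * t := by positivity
    linarith
  rw [qDensityTerm, norm_mul, norm_mul, norm_mul, norm_mul, Real.norm_eq_abs, Real.norm_eq_abs,
    Real.norm_eq_abs, Real.norm_of_nonneg (omegaAff_nonneg hk0 n),
    Real.norm_of_nonneg (Real.rpow_nonneg hs _), abs_of_pos (Real.exp_pos _)]
  calc _ ≤ Real.exp (-(π ^ 2 / 2 * t * n ^ 2)) * ((k + 1 + n) * (2 * (k + 1 + n)) ^ n) *
        ((k + 1 + n) * (2 * (k + 1 + n)) ^ n) *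
        (Real.Gamma k ^ 2 / (2 ^ (1 - 2 * k) * Real.Gamma (2 * k)) * (k + 1 + n)) * 1 := by
        have := omegaAff_nonneg hk0 n
        have := Real.rpow_nonneg hs (2 * k)
        gcongr
    _ = _ := by
        generalize k + 1 + (n : ℝ) = s
        rw [show 4 * s ^ 2 = (2 * s) * (2 * s) by ring, mul_pow (2 * s) (2 * s)]
        ring

lemma integral_qDensityTerm {k : ℝ} (hk : 1 / 2 ≤ k) (t x : ℝ) (n : ℕ) :
    ∫ y in Set.Ioo (0 : ℝ) 1, qDensityTerm k t x n y = if n = 0 then 1 else 0 := by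
  have hk0 : 0 < k := by linarith
  have he : ∀ y, qDensityTerm k t x n y =
      Real.exp (-(lambdaAff k n) * t) * gegenbauer k n (Real.cos (π * x)) * omegaAff k n *
        (Real.sin (π * y) ^ (2 * k) * gegenbauer k n (Real.cos (π * y))) := by
    intro y; unfold qDensityTerm; ring
  simp only [he]
  rw [← integral_Ioc_eq_integral_Ioo, ← intervalIntegral.integral_of_le zero_le_one,
    intervalIntegral.integral_const_mul]
  split_ifs with hn
  · subst hn
    have hG : ∀ z, gegenbauer k 0 z = 1 := by
      intro z
      simp [gegenbauer, (Real.Gamma_pos_of_pos hk0).ne']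
    have h := omegaAff_zero_mul_trigMoment_zero hk
    simpa [hG, lambdaAff, trigMoment] using h
  · rw [integral_sin_rpow_mul_gegenbauer hk0 hn, mul_zero]

theorem qDensity_integral_eq_one (k : ℝ) (hk : 1 / 2 ≤ k)
    (t : ℝ) (ht : 0 < t) (x : ℝ) (hx : x ∈ Set.Ioo (0 : ℝ) 1) :
    ∫ y in Set.Ioo (0 : ℝ) 1, qDensity k t x y = 1 := by
  have hk0 : 0 < k := by linarith
  have hint : ∀ n, IntegrableOn (qDensityTerm k t x n) (Set.Ioo 0 1) := fun n =>
    ((continuous_qDensityTerm hk0 t x n).continuousOn.integrableOn_Icc).mono_set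
      Set.Ioo_subset_Icc_self
  have hsum : Summable fun n => ∫ y in Set.Ioo (0 : ℝ) 1, ‖qDensityTerm k t x n y‖ := by
    refine Summable.of_nonneg_of_le (fun n => integral_nonneg fun _ => norm_nonneg _) (fun n => ?_)
      ((summable_pow_mul_pow_mul_exp_neg_sq (a := k + 1) (c := π ^ 2 / 2 * t) (by linarith)
        (by positivity)).mul_left
        (Real.Gamma k ^ 2 / (2 ^ (1 - 2 * k) * Real.Gamma (2 * k))))
    refine (setIntegral_mono_on (hint n).norm (integrableOn_const (by simp)) measurableSet_Ioo
      fun y hy => norm_qDensityTerm_le hk ht x n (Set.Ioo_subset_Icc_self hy)).trans ?_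
    simp
  change ∫ y in Set.Ioo (0 : ℝ) 1, ∑' n, qDensityTerm k t x n y = 1
  rw [← integral_tsum_of_summable_integral_norm hint hsum]
  simp only [integral_qDensityTerm hk, tsum_ite_eq]
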